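/- The LQR cost f is coercive on S in the following sense: (i) for every sequence (K_j) in S converging to a point K on the boundary ∂S (i.e., ρ(A−BK) = 1), one has f(K_j) → +∞; and (ii) for every sequence (K_j) in S with ‖K_j‖_F → ∞, one has f(K_j) → +∞. -/

import Mathlib

open Matrix

/-- `M` is Schur stable: spectral radius `ρ(M) < 1`. -/
def IsSchur {k : ℕ} (M : Matrix (Fin k) (Fin k) ℝ) : Prop :=
  ∀ μ ∈ spectrum ℂ (M.map (Complex.ofReal ·)), ‖μ‖ < 1

/-- The Frobenius norm of a real matrix. -/
noncomputable def frobNorm {a b : ℕ} (K : Matrix (Fin a) (Fin b) ℝ) : ℝ :=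
  Real.sqrt (∑ i, ∑ j, (K i j) ^ 2)

open Filter Topology

theorem Matrix.PosDef.exists_smul_one_le {k : ℕ} {S : Matrix (Fin k) (Fin k) ℝ} (hS : S.PosDef) :
    ∃ c : ℝ, 0 < c ∧ (S - c • (1 : Matrix (Fin k) (Fin k) ℝ)).PosSemidef := by
  rcases isEmpty_or_nonempty (Fin k) with h | h
  · exact ⟨1, one_pos, by rw [Subsingleton.elim (S - _) 0]; exact .zero⟩
  · open scoped MatrixOrder in
    obtain ⟨c, hc, h⟩ := (CFC.exists_pos_algebraMap_le_iff hS.isHermitian.isSelfAdjoint).2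
      fun x hx ↦ hS.isStrictlyPositive.spectrum_pos hx
    exact ⟨c, hc, by rwa [← Algebra.algebraMap_eq_smul_one, ← Matrix.le_iff]⟩

theorem Matrix.PosDef.exists_mul_trace_le_trace_conj {k : ℕ} {S : Matrix (Fin k) (Fin k) ℝ}
    (hS : S.PosDef) : ∃ c : ℝ, 0 < c ∧ ∀ {l : ℕ} (C : Matrix (Fin k) (Fin l) ℝ),
      c * trace (Cᵀ * C) ≤ trace (Cᵀ * S * C) := by
  obtain ⟨c, hc, h⟩ := hS.exists_smul_one_le
  refine ⟨c, hc, fun C ↦ ?_⟩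
  have := (h.conjTranspose_mul_mul_same C).trace_nonneg
  rw [conjTranspose_eq_transpose_of_trivial] at this
  simpa [Matrix.mul_sub, Matrix.sub_mul] using this

theorem Matrix.PosDef.exists_mul_trace_le_trace_mul {k : ℕ} {S : Matrix (Fin k) (Fin k) ℝ}
    (hS : S.PosDef) : ∃ c : ℝ, 0 < c ∧ ∀ W : Matrix (Fin k) (Fin k) ℝ, W.PosSemidef →
      c * trace W ≤ trace (W * S) := by
  obtain ⟨c, hc, h⟩ := hS.exists_mul_trace_le_trace_conj
  refine ⟨c, hc, fun W hW ↦ ?_⟩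
  open scoped MatrixOrder in
  obtain ⟨C, rfl⟩ := CStarAlgebra.nonneg_iff_eq_star_mul_self.1 hW.nonneg
  have := h Cᵀ
  rw [transpose_transpose, trace_mul_comm, trace_mul_cycle] at this
  simpa [star_eq_conjTranspose] using this

theorem tendsto_pow_zero_of_spectralRadius_lt_one {E : Type*} [NormedRing E] [NormedAlgebra ℂ E]
    [CompleteSpace E] {a : E} (ha : spectralRadius ℂ a < 1) :
    Tendsto (fun t : ℕ ↦ a ^ t) atTop (𝓝 0) := by
  obtain ⟨r, har, hr⟩ := ENNReal.lt_iff_exists_nnreal_btwn.1 ha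
  have hr1 : (r : ℝ) < 1 := by exact_mod_cast hr
  refine squeeze_zero_norm' ?_ (tendsto_pow_atTop_nhds_zero_of_lt_one r.2 hr1)
  filter_upwards [(spectrum.pow_nnnorm_pow_one_div_tendsto_nhds_spectralRadius a).eventually_lt_const
    har, eventually_gt_atTop 0] with t ht h0
  have h := ENNReal.rpow_le_rpow ht.le (Nat.cast_nonneg t : (0 : ℝ) ≤ t)
  rw [← ENNReal.rpow_mul, one_div_mul_cancel (by positivity), ENNReal.rpow_one,
    ENNReal.rpow_natCast] at h
  exact_mod_cast h

section Frobenius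

attribute [local instance] Matrix.frobeniusNormedRing Matrix.frobeniusNormedAlgebra

theorem frobenius_norm_map_ofReal_sq {k : ℕ} (M : Matrix (Fin k) (Fin k) ℝ) :
    ‖M.map (Complex.ofReal ·)‖ ^ 2 = trace (Mᵀ * M) := by
  rw [frobenius_norm_def, ← Real.sqrt_eq_rpow, Real.sq_sqrt (by positivity), Finset.sum_comm]
  simp [trace, Matrix.mul_apply, sq]

theorem map_ofReal_pow {k : ℕ} (M : Matrix (Fin k) (Fin k) ℝ) (t : ℕ) :
    (M ^ t).map (Complex.ofReal ·) = M.map (Complex.ofReal ·) ^ t :=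
  map_pow Complex.ofRealHom.mapMatrix M t

theorem IsSchur.tendsto_pow {k : ℕ} {M : Matrix (Fin k) (Fin k) ℝ} (hM : IsSchur M) :
    Tendsto (fun t : ℕ ↦ M ^ t) atTop (𝓝 0) := by
  rcases isEmpty_or_nonempty (Fin k) with h | h
  · exact tendsto_const_nhds.congr fun t ↦ Subsingleton.elim _ _
  · have : CompleteSpace (Matrix (Fin k) (Fin k) ℂ) := FiniteDimensional.complete ℂ _
    have h := tendsto_pow_zero_of_spectralRadius_lt_one
      (a := M.map (Complex.ofReal ·)) (spectrum.spectralRadius_lt_of_forall_lt (r := 1) _ hM)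
    refine tendsto_pi_nhds.2 fun i ↦ tendsto_pi_nhds.2 fun j ↦ ?_
    have h2 := (Complex.continuous_re.comp (continuous_id.matrix_elem i j)).tendsto
      (0 : Matrix (Fin k) (Fin k) ℂ) |>.comp h
    refine (h2.congr fun t ↦ ?_).trans (by simp)
    simp [← map_ofReal_pow]

theorem exists_le_trace_pow_of_not_isSchur (k : ℕ) : ∃ c : ℝ, 0 < c ∧
    ∀ M : Matrix (Fin k) (Fin k) ℝ, ¬ IsSchur M → ∀ t : ℕ, c ≤ trace ((M ^ t)ᵀ * M ^ t) := by
  set b := ‖(1 : Matrix (Fin k) (Fin k) ℂ)‖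
  refine ⟨((b + 1)⁻¹) ^ 2, by positivity, fun M hM t ↦ ?_⟩
  simp only [IsSchur, not_forall, not_lt] at hM
  obtain ⟨μ, hμ, h1⟩ := hM
  have : CompleteSpace (Matrix (Fin k) (Fin k) ℂ) := FiniteDimensional.complete ℂ _
  have h := spectrum.norm_le_norm_mul_of_mem (spectrum.pow_mem_pow _ t hμ)
  rw [← map_ofReal_pow, norm_pow] at h
  rw [← frobenius_norm_map_ofReal_sq]
  have h3 := (one_le_pow₀ h1).trans h
  have h4 : 1 ≤ ‖(M ^ t).map (Complex.ofReal ·)‖ * (b + 1) := by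
    nlinarith [norm_nonneg ((M ^ t).map (Complex.ofReal ·))]
  gcongr
  rwa [inv_le_iff_one_le_mul₀ (by positivity)]

end Frobenius

theorem isOpen_setOf_isSchur (k : ℕ) : IsOpen {M : Matrix (Fin k) (Fin k) ℝ | IsSchur M} := by
  obtain ⟨c, hc, h⟩ := exists_le_trace_pow_of_not_isSchur k
  rw [isOpen_iff_mem_nhds]
  intro M hM
  have hcont (t : ℕ) : Continuous fun M : Matrix (Fin k) (Fin k) ℝ ↦ trace ((M ^ t)ᵀ * M ^ t) := by
    fun_prop
  have h0 : Tendsto (fun t : ℕ ↦ trace ((M ^ t)ᵀ * M ^ t)) atTop (𝓝 0) := by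
    simpa [Function.comp_def] using ((hcont 1).tendsto 0).comp (IsSchur.tendsto_pow hM)
  obtain ⟨t, ht⟩ := (h0.eventually_lt_const hc).exists
  filter_upwards [(hcont t).continuousAt.eventually_lt_const ht] with M' hM'
  by_contra hs
  exact (h M' hs t).not_gt hM'

theorem lyapunov_iterate {k : ℕ} {M P X : Matrix (Fin k) (Fin k) ℝ} (h : Mᵀ * X * M + P = X)
    (N : ℕ) :
    X = ∑ t ∈ Finset.range N, (M ^ t)ᵀ * P * M ^ t + (M ^ N)ᵀ * X * M ^ N := by
  induction N with
  | zero => simp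
  | succ N ih =>
    have h2 : (M ^ N)ᵀ * X * M ^ N =
        (M ^ N)ᵀ * P * M ^ N + (M ^ (N + 1))ᵀ * X * M ^ (N + 1) := by
      conv_lhs => rw [← h]
      rw [pow_succ', transpose_mul]
      noncomm_ring
    rw [Finset.sum_range_succ, add_assoc, ← h2]
    exact ih

theorem trace_mul_nonneg_of_posSemidef_of_posDef {k : ℕ} {W S : Matrix (Fin k) (Fin k) ℝ}
    (hW : W.PosSemidef)
    (hS : S.PosDef) : 0 ≤ trace (W * S) := by
  obtain ⟨c, hc, h⟩ := hS.exists_mul_trace_le_trace_mul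
  exact (mul_nonneg hc.le hW.trace_nonneg).trans (h W hW)

theorem sum_trace_le_trace_lyapunov {k : ℕ} {M P X S : Matrix (Fin k) (Fin k) ℝ}
    (hM : IsSchur M) (h : Mᵀ * X * M + P = X) (hP : P.PosSemidef) (hS : S.PosDef) (N : ℕ) :
    ∑ t ∈ Finset.range N, trace ((M ^ t)ᵀ * P * M ^ t * S) ≤ trace (X * S) := by
  have hcont : Continuous fun Y : Matrix (Fin k) (Fin k) ℝ ↦ trace (Yᵀ * X * Y * S) := by
    fun_prop
  have h0 : Tendsto (fun t : ℕ ↦ trace ((M ^ t)ᵀ * X * M ^ t * S)) atTop (𝓝 0) := by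
    simpa [Function.comp_def] using (hcont.tendsto 0).comp hM.tendsto_pow
  have heq (T : ℕ) : ∑ t ∈ Finset.range T, trace ((M ^ t)ᵀ * P * M ^ t * S) =
      trace (X * S) - trace ((M ^ T)ᵀ * X * M ^ T * S) := by
    have := congrArg (fun Y ↦ trace (Y * S)) (lyapunov_iterate h T)
    simp only [Matrix.add_mul, trace_add, Finset.sum_mul, trace_sum] at this
    linarith
  have hlim : Tendsto (fun T ↦ ∑ t ∈ Finset.range T, trace ((M ^ t)ᵀ * P * M ^ t * S)) atTop
      (𝓝 (trace (X * S))) := by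
    simp only [heq]
    simpa using h0.const_sub (trace (X * S))
  refine Monotone.ge_of_tendsto (monotone_nat_of_le_succ fun T ↦ ?_) hlim N
  rw [Finset.sum_range_succ, le_add_iff_nonneg_right]
  refine trace_mul_nonneg_of_posSemidef_of_posDef ?_ hS
  simpa using hP.conjTranspose_mul_mul_same (M ^ T)

theorem frobNorm_sq {a b : ℕ} (K : Matrix (Fin a) (Fin b) ℝ) :
    frobNorm K ^ 2 = trace (Kᵀ * K) := by
  rw [frobNorm, Real.sq_sqrt (by positivity), Finset.sum_comm]
  simp [trace, Matrix.mul_apply, sq]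

theorem stmt3 {n m : ℕ} (hn : 0 < n) (hm : 0 < m)
    (A : Matrix (Fin n) (Fin n) ℝ) (B : Matrix (Fin n) (Fin m) ℝ)
    (Q Sig : Matrix (Fin n) (Fin n) ℝ) (R : Matrix (Fin m) (Fin m) ℝ)
    (hQ : Q.PosDef) (hR : R.PosDef) (hSig : Sig.PosDef)
    (X : Matrix (Fin m) (Fin n) ℝ → Matrix (Fin n) (Fin n) ℝ)
    (hX : ∀ K, IsSchur (A - B * K) →
      (A - B * K)ᵀ * X K * (A - B * K) + Kᵀ * R * K + Q = X K) :
    (∀ (Kj : ℕ → Matrix (Fin m) (Fin n) ℝ) (K : Matrix (Fin m) (Fin n) ℝ),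
      (∀ j, IsSchur (A - B * Kj j)) →
      Filter.Tendsto Kj Filter.atTop (nhds K) →
      K ∈ frontier {K' : Matrix (Fin m) (Fin n) ℝ | IsSchur (A - B * K')} →
      Filter.Tendsto (fun j => Matrix.trace (X (Kj j) * Sig)) Filter.atTop Filter.atTop) ∧
    (∀ Kj : ℕ → Matrix (Fin m) (Fin n) ℝ,
      (∀ j, IsSchur (A - B * Kj j)) →
      Filter.Tendsto (fun j => frobNorm (Kj j)) Filter.atTop Filter.atTop →
      Filter.Tendsto (fun j => Matrix.trace (X (Kj j) * Sig)) Filter.atTop Filter.atTop) := by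
  obtain ⟨s, hs, hSig'⟩ := hSig.exists_mul_trace_le_trace_mul
  obtain ⟨q, hq, hQ'⟩ := hQ.exists_mul_trace_le_trace_conj
  obtain ⟨r, hr, hR'⟩ := hR.exists_mul_trace_le_trace_conj
  have hKRK (K : Matrix (Fin m) (Fin n) ℝ) : (Kᵀ * R * K).PosSemidef := by
    simpa using hR.posSemidef.conjTranspose_mul_mul_same K
  have hP (K : Matrix (Fin m) (Fin n) ℝ) : (Kᵀ * R * K + Q).PosSemidef :=
    (hKRK K).add hQ.posSemidef
  have hX' (K : Matrix (Fin m) (Fin n) ℝ) (hK : IsSchur (A - B * K)) :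
      (A - B * K)ᵀ * X K * (A - B * K) + (Kᵀ * R * K + Q) = X K := by
    rw [← add_assoc, hX K hK]
  constructor
  · intro Kj K hKj hlim hK
    have hcl : Continuous fun K' : Matrix (Fin m) (Fin n) ℝ ↦ A - B * K' := by fun_prop
    have hopen : IsOpen {K' : Matrix (Fin m) (Fin n) ℝ | IsSchur (A - B * K')} :=
      (isOpen_setOf_isSchur n).preimage hcl
    have hns : ¬ IsSchur (A - B * K) := by
      rw [hopen.frontier_eq] at hK
      exact hK.2
    obtain ⟨c, hc, hns'⟩ := exists_le_trace_pow_of_not_isSchur n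
    have hlow := hns' _ hns
    have key (j N : ℕ) : s * q * ∑ t ∈ Finset.range N,
        trace (((A - B * Kj j) ^ t)ᵀ * (A - B * Kj j) ^ t) ≤ trace (X (Kj j) * Sig) := by
      refine le_trans ?_ (sum_trace_le_trace_lyapunov (hKj j) (hX' _ (hKj j)) (hP _) hSig N)
      rw [Finset.mul_sum]
      refine Finset.sum_le_sum fun t _ ↦ ?_
      set Y := (A - B * Kj j) ^ t
      have h1 : (Yᵀ * ((Kj j)ᵀ * R * Kj j + Q) * Y).PosSemidef := by
        simpa using (hP (Kj j)).conjTranspose_mul_mul_same Y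
      have h2 : 0 ≤ trace (Yᵀ * ((Kj j)ᵀ * R * Kj j) * Y) := by
        simpa using ((hKRK (Kj j)).conjTranspose_mul_mul_same Y).trace_nonneg
      refine le_trans ?_ (hSig' _ h1)
      rw [mul_assoc, Matrix.mul_add, Matrix.add_mul, trace_add]
      gcongr
      linarith [hQ' Y]
    rw [tendsto_atTop]
    intro C
    obtain ⟨N, hN⟩ := exists_nat_gt (C / (s * q * c))
    rw [div_lt_iff₀ (by positivity)] at hN
    have hcont : Continuous fun K' : Matrix (Fin m) (Fin n) ℝ ↦ s * q * ∑ t ∈ Finset.range N,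
        trace (((A - B * K') ^ t)ᵀ * (A - B * K') ^ t) := by fun_prop
    have hlt : C < s * q * ∑ t ∈ Finset.range N,
        trace (((A - B * K) ^ t)ᵀ * (A - B * K) ^ t) := by
      have := Finset.card_nsmul_le_sum (Finset.range N) _ c fun t _ ↦ hlow t
      rw [Finset.card_range, nsmul_eq_mul] at this
      calc C < s * q * (N * c) := by linarith
        _ ≤ _ := by gcongr
    filter_upwards [((hcont.tendsto K).comp hlim).eventually_const_lt hlt] with j hj
    exact hj.le.trans (key j N)
  · intro Kj hKj hlim
    have hsq : Tendsto (fun j ↦ s * r * frobNorm (Kj j) ^ 2) atTop atTop :=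
      ((tendsto_pow_atTop two_ne_zero).comp hlim).const_mul_atTop (by positivity)
    refine tendsto_atTop_mono (fun j ↦ ?_) hsq
    have h1 := sum_trace_le_trace_lyapunov (hKj j) (hX' _ (hKj j)) (hP _) hSig 1
    simp only [Finset.sum_range_one, pow_zero, transpose_one, Matrix.one_mul,
      Matrix.mul_one] at h1
    refine le_trans ?_ ((hSig' _ (hP (Kj j))).trans h1)
    rw [mul_assoc, trace_add, frobNorm_sq]
    gcongr
    linarith [hR' (Kj j), hQ.posSemidef.trace_nonneg]
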